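/- Let G be a context-free grammar over a type T of terminals whose type of nonterminals is finite, such that every nonterminal is the left-hand side (input) of exactly one production rule, and such that G is non-recursive — i.e., for every nonterminal A, no sentential form reachable from the one-symbol string [A] by one or more production steps contains the symbol A. Then G generates exactly one word: there exists a unique terminal word s with G.language = {s}. -/

import Mathlib

namespace ContextFreeGrammar

variable {T : Type*} {G : ContextFreeGrammar T}

/-- `G.Occurs B A` means that some rule of `G` for `A` has `B` on its right-hand side. -/
def Occurs (G : ContextFreeGrammar T) (B A : G.NT) : Prop :=
  ∃ r ∈ G.rules, r.input = A ∧ Symbol.nonterminal B ∈ r.output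

lemma produces_output {r : ContextFreeRule T G.NT} (hr : r ∈ G.rules) :
    G.Produces [Symbol.nonterminal r.input] r.output :=
  ⟨r, hr, .input_output⟩

lemma Derives.append {u u' v v' : List (Symbol T G.NT)} (hu : G.Derives u u')
    (hv : G.Derives v v') : G.Derives (u ++ v) (u' ++ v') :=
  (hu.append_right v).trans (hv.append_left u')

lemma exists_transGen_produces_of_transGen_occurs {A B : G.NT}
    (h : Relation.TransGen G.Occurs B A) :
    ∃ u, Relation.TransGen G.Produces [Symbol.nonterminal A] u ∧ Symbol.nonterminal B ∈ u := by
  induction h with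
  | single h =>
    obtain ⟨r, hr, rfl, hB⟩ := h
    exact ⟨r.output, .single (produces_output hr), hB⟩
  | tail _ h ih =>
    obtain ⟨r, hr, rfl, hM⟩ := h
    obtain ⟨u, hu, hB⟩ := ih
    obtain ⟨p, q, hpq⟩ := List.append_of_mem hM
    refine ⟨p ++ (u ++ q), .head' (produces_output hr) ?_, by simp [hB]⟩
    rw [hpq]
    have hu' : G.Derives _ u := hu.to_reflTransGen
    exact (hu'.append_right q).append_left p

lemma wellFounded_transGen_occurs [Finite G.NT]
    (hnr : ∀ A : G.NT, ∀ u : List (Symbol T G.NT),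
      Relation.TransGen G.Produces [Symbol.nonterminal A] u → Symbol.nonterminal A ∉ u) :
    WellFounded (Relation.TransGen G.Occurs) := by
  have : Std.Irrefl (Relation.TransGen G.Occurs) := ⟨fun A h ↦ by
    obtain ⟨u, hu, hA⟩ := exists_transGen_produces_of_transGen_occurs h
    exact hnr A u hu hA⟩
  exact Finite.wellFounded_of_trans_of_irrefl _

lemma exists_derives_map_terminal {u : List (Symbol T G.NT)}
    (h : ∀ A, Symbol.nonterminal A ∈ u →
      ∃ w : List T, G.Derives [Symbol.nonterminal A] (w.map Symbol.terminal)) :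
    ∃ w : List T, G.Derives u (w.map Symbol.terminal) := by
  induction u with
  | nil => exact ⟨[], .refl _⟩
  | cons x u ih =>
    obtain ⟨w, hw⟩ := ih fun A hA ↦ h A (List.mem_cons_of_mem _ hA)
    obtain ⟨v, hv⟩ : ∃ v : List T, G.Derives [x] (v.map Symbol.terminal) := by
      cases x with
      | terminal t => exact ⟨[t], .refl _⟩
      | nonterminal A => exact h A List.mem_cons_self
    exact ⟨v ++ w, by simpa using hv.append hw⟩

lemma exists_nonterminal_derives_map_terminal (hwf : WellFounded (Relation.TransGen G.Occurs))
    (hex : ∀ A : G.NT, ∃ r ∈ G.rules, r.input = A) (A : G.NT) :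
    ∃ w : List T, G.Derives [Symbol.nonterminal A] (w.map Symbol.terminal) := by
  induction A using hwf.induction with
  | _ A ih =>
    obtain ⟨r, hr, rfl⟩ := hex A
    obtain ⟨w, hw⟩ := exists_derives_map_terminal (u := r.output) fun B hB ↦
      ih B (.single ⟨r, hr, rfl, hB⟩)
    exact ⟨w, (produces_output hr).trans_derives hw⟩

lemma Produces.eq_or_exists_produces
    (huniq : ∀ r ∈ G.rules, ∀ r' ∈ G.rules, r.input = r'.input → r = r')
    {u v w : List (Symbol T G.NT)} (hv : G.Produces u v) (hw : G.Produces u w) :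
    v = w ∨ ∃ x, G.Produces v x ∧ G.Produces w x := by
  obtain ⟨r, hr, hv⟩ := hv
  obtain ⟨r', hr', hw⟩ := hw
  induction hv generalizing w with
  | head s =>
    generalize hu : Symbol.nonterminal r.input :: s = u at hw
    cases hw with
    | head s' =>
      simp only [List.cons.injEq, Symbol.nonterminal.injEq] at hu
      obtain ⟨hi, rfl⟩ := hu
      obtain rfl := huniq r hr r' hr' hi
      exact .inl rfl
    | @cons x s₁ s₂ h =>
      simp only [List.cons.injEq] at hu
      obtain ⟨rfl, rfl⟩ := hu
      exact .inr ⟨r.output ++ s₂, ⟨r', hr', h.append_left _⟩, ⟨r, hr, .head s₂⟩⟩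
  | @cons x s₁ s₂ h ih =>
    cases hw with
    | head => exact .inr ⟨r'.output ++ s₂, ⟨r', hr', .head s₂⟩, ⟨r, hr, h.append_left _⟩⟩
    | cons _ h' =>
      obtain rfl | ⟨y, hy, hy'⟩ := ih h'
      · exact .inl rfl
      · exact .inr ⟨x :: y, hy.append_left [x], hy'.append_left [x]⟩

lemma Derives.eq_of_map_terminal {w : List T} {u : List (Symbol T G.NT)}
    (h : G.Derives (w.map Symbol.terminal) u) : w.map Symbol.terminal = u := by
  obtain h | ⟨v, hv, -⟩ := h.eq_or_head
  · exact h
  · obtain ⟨r, -, hr⟩ := hv.exists_nonterminal_input_mem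
    simp at hr

lemma Derives.map_terminal_unique
    (huniq : ∀ r ∈ G.rules, ∀ r' ∈ G.rules, r.input = r'.input → r = r')
    {u : List (Symbol T G.NT)} {v w : List T} (hv : G.Derives u (v.map Symbol.terminal))
    (hw : G.Derives u (w.map Symbol.terminal)) : v = w := by
  obtain ⟨x, hx, hx'⟩ := Relation.church_rosser (fun a b c hb hc ↦ by
    obtain rfl | ⟨d, hd, hd'⟩ := Produces.eq_or_exists_produces huniq hb hc
    · exact ⟨b, .refl, .refl⟩
    · exact ⟨d, .single hd, .single hd'⟩) hv hw
  have hinj : Function.Injective (Symbol.terminal : T → Symbol T G.NT) :=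
    fun _ _ ↦ Symbol.terminal.inj
  exact hinj.list_map
    ((Derives.eq_of_map_terminal hx).trans (Derives.eq_of_map_terminal hx').symm)

end ContextFreeGrammar

/-- A straight-line grammar (finitely many nonterminals, exactly one rule per nonterminal,
non-recursive) generates exactly one word. -/
theorem straight_line_language_singleton {T : Type*} (G : ContextFreeGrammar T)
    [Fintype G.NT]
    (hone : ∀ A : G.NT, ∃! r : ContextFreeRule T G.NT, r ∈ G.rules ∧ r.input = A)
    (hnr : ∀ A : G.NT, ∀ u : List (Symbol T G.NT),
      Relation.TransGen G.Produces [Symbol.nonterminal A] u → Symbol.nonterminal A ∉ u) :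
    ∃! s : List T, G.language = {s} := by
  obtain ⟨s, hs⟩ := ContextFreeGrammar.exists_nonterminal_derives_map_terminal
    (ContextFreeGrammar.wellFounded_transGen_occurs hnr) (fun A ↦ (hone A).exists) G.initial
  have huniq : ∀ r ∈ G.rules, ∀ r' ∈ G.rules, r.input = r'.input → r = r' :=
    fun r hr r' hr' h ↦ (hone r'.input).unique ⟨hr, h⟩ ⟨hr', rfl⟩
  have hlang : G.language = {s} := Set.ext fun w ↦
    ⟨fun hw ↦ ContextFreeGrammar.Derives.map_terminal_unique huniq hw hs,
      fun hw ↦ by obtain rfl : w = s := hw; exact hs⟩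
  exact ⟨s, hlang, fun t ht ↦ Set.singleton_injective (ht.symm.trans hlang)⟩
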